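/- Let 0 ≤ a < 1 < b ≤ ∞, let f : (a,b) → ℝ be convex with f(1) = 0, let ℒ : 𝒵 → ℝ be measurable, let P_n be the empirical distribution of points z_1, …, z_n ∈ 𝒵, and let c > 0. Then the Gibbs variational formula holds: inf_{Q : D_f(Q‖P_n) < ∞} { E_Q[ℒ] + c D_f(Q‖P_n) } = −c inf_{ν ∈ ℝ} { ν + E_{P_n}[ f*( −ℒ/c − ν ) ] }, where f* is the Legendre transform of f (with f extended continuously to the endpoints of its domain). -/

import Mathlib

open MeasureTheory Classical
open scoped ENNReal BigOperators

/-- The empirical distribution `P_n = (1/n) ∑ᵢ δ_{zᵢ}` of points `z₁, …, zₙ`. -/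
noncomputable def empDist {𝒵 : Type*} [MeasurableSpace 𝒵] (n : ℕ) (z : Fin n → 𝒵) :
    Measure 𝒵 :=
  ((n : ℝ≥0∞))⁻¹ • ∑ i : Fin n, Measure.dirac (z i)

/-- The `f`-divergence for `f` defined on the interval `(a, b)` (with `b` possibly `∞`):
`D_f(Q ‖ P) = E_P[f(dQ/dP)]` when `Q ≪ P`, `dQ/dP` takes values in `[a, b]` a.e. (where `f`
is understood as continuously extended to the endpoints) and the integrand is integrable;
`∞` otherwise. -/
noncomputable def fDivOn {Ω : Type*} [MeasurableSpace Ω] (a : ℝ) (b : EReal) (f : ℝ → ℝ)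
    (Q P : Measure Ω) : EReal :=
  if Q ≪ P ∧ (∀ᵐ ω ∂P, a ≤ ((Q.rnDeriv P) ω).toReal ∧ (((Q.rnDeriv P) ω).toReal : EReal) ≤ b)
      ∧ Integrable (fun ω => f ((Q.rnDeriv P) ω).toReal) P
  then ((∫ ω, f ((Q.rnDeriv P) ω).toReal ∂P : ℝ) : EReal)
  else ⊤

/-- The Legendre transform `f*(y) = sup_{x ∈ (a,b)} {yx − f(x)}` of `f : (a,b) → ℝ`. -/
noncomputable def fStarOn (a : ℝ) (b : EReal) (f : ℝ → ℝ) (y : ℝ) : EReal :=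
  ⨆ x : {x : ℝ // a < x ∧ (x : EReal) < b}, ((y * (x : ℝ) - f x : ℝ) : EReal)

lemma emp_ae {𝒵 : Type*} [MeasurableSpace 𝒵] (n : ℕ) (z : Fin n → 𝒵) (p : 𝒵 → Prop)
    (h : ∀ᵐ x ∂(empDist n z), p x) (i : Fin n) : p (z i) := by
  by_contra hp
  have h0 : empDist n z {x | ¬ p x} = 0 := h
  obtain ⟨t, hst, ht, ht0⟩ := exists_measurable_superset_of_null h0
  have hi : z i ∈ t := hst hp
  simp only [empDist, Measure.smul_apply, Measure.finsetSum_apply, smul_eq_mul, mul_eq_zero,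
    ENNReal.inv_eq_zero, ENNReal.natCast_ne_top, false_or, Finset.sum_eq_zero_iff] at ht0
  have := ht0 i (Finset.mem_univ _)
  rw [Measure.dirac_apply' _ ht] at this
  simp [hi] at this

lemma emp_ae' {𝒵 : Type*} [MeasurableSpace 𝒵] (n : ℕ) (z : Fin n → 𝒵) (p : 𝒵 → Prop)
    (h : ∀ i, p (z i)) (hp : MeasurableSet {x | p x}) : ∀ᵐ x ∂(empDist n z), p x := by
  have hc : MeasurableSet {x | ¬ p x} := hp.compl
  show empDist n z {x | ¬ p x} = 0
  simp only [empDist, Measure.smul_apply, Measure.finsetSum_apply, smul_eq_mul, mul_eq_zero]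
  right
  refine Finset.sum_eq_zero fun i _ => ?_
  rw [Measure.dirac_apply' _ hc]
  simp [h i]

lemma emp_prob {𝒵 : Type*} [MeasurableSpace 𝒵] (n : ℕ) (hn : 0 < n) (z : Fin n → 𝒵) :
    IsProbabilityMeasure (empDist n z) := by
  constructor
  simp only [empDist, Measure.smul_apply, Measure.finsetSum_apply, smul_eq_mul, measure_univ,
    Finset.sum_const, Finset.card_univ, Fintype.card_fin, nsmul_eq_mul, mul_one]
  exact ENNReal.inv_mul_cancel (by exact_mod_cast hn.ne') (by simp)

lemma emp_integrable {𝒵 : Type*} [MeasurableSpace 𝒵] (n : ℕ) (hn : 0 < n) (z : Fin n → 𝒵)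
    (g : 𝒵 → ℝ) (hg : StronglyMeasurable g) : Integrable g (empDist n z) := by
  unfold empDist
  refine Integrable.smul_measure ?_ (by simp; omega)
  rw [integrable_finsetSum_measure]
  intro i _
  exact integrable_dirac' hg (by simp)

lemma emp_integral {𝒵 : Type*} [MeasurableSpace 𝒵] (n : ℕ) (z : Fin n → 𝒵)
    (g : 𝒵 → ℝ) (hg : AEStronglyMeasurable g (empDist n z)) :
    ∫ x, g x ∂(empDist n z) = (n : ℝ)⁻¹ * ∑ i, g (z i) := by
  have h1 : ∀ i, g (z i) = hg.mk g (z i) := emp_ae n z _ hg.ae_eq_mk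
  rw [integral_congr_ae hg.ae_eq_mk]
  simp only [h1]
  have hs := hg.stronglyMeasurable_mk
  generalize hg.mk g = k at hs ⊢
  unfold empDist
  rw [integral_smul_measure, integral_finsetSum_measure]
  · simp [integral_dirac' _ _ hs]
  · intro i _
    exact integrable_dirac' hs (by simp)

lemma fStar_ge (a : ℝ) (b : EReal) (ha1 : (a : EReal) < 1) (hb1 : (1 : EReal) < b)
    (f : ℝ → ℝ)
    (hfa : ContinuousWithinAt f (Set.Ioi a) a)
    (hfb : ∀ c : ℝ, b = (c : EReal) → ContinuousWithinAt f (Set.Iio c) c)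
    (y q : ℝ) (hqa : a ≤ q) (hqb : (q : EReal) ≤ b) :
    ((y * q - f q : ℝ) : EReal) ≤ fStarOn a b f y := by
  have key : ∀ x : ℝ, a < x → (x : EReal) < b → ((y * x - f x : ℝ) : EReal) ≤ fStarOn a b f y :=
    fun x h1 h2 => le_iSup (fun x : {x : ℝ // a < x ∧ (x : EReal) < b} =>
      ((y * (x : ℝ) - f x : ℝ) : EReal)) ⟨x, h1, h2⟩
  have ha1' : a < 1 := by exact_mod_cast ha1
  rcases hqa.eq_or_lt with rfl | h1
  · have ht : Filter.Tendsto (fun x => ((y * x - f x : ℝ) : EReal)) (nhdsWithin a (Set.Ioi a))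
        (nhds ((y * a - f a : ℝ) : EReal)) := by
      refine (continuous_coe_real_ereal.tendsto _).comp ?_
      exact ((continuous_const.mul continuous_id).continuousWithinAt.tendsto).sub hfa
    refine le_of_tendsto ht ?_
    filter_upwards [Ioo_mem_nhdsGT ha1'] with x hx
    exact key x hx.1 (lt_trans (by exact_mod_cast hx.2) hb1)
  rcases hqb.eq_or_lt with h2 | h2
  · have hfq := hfb q h2.symm
    have h1q : 1 < q := by rw [← h2] at hb1; exact_mod_cast hb1
    have ht : Filter.Tendsto (fun x => ((y * x - f x : ℝ) : EReal)) (nhdsWithin q (Set.Iio q))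
        (nhds ((y * q - f q : ℝ) : EReal)) := by
      refine (continuous_coe_real_ereal.tendsto _).comp ?_
      exact ((continuous_const.mul continuous_id).continuousWithinAt.tendsto).sub hfq
    refine le_of_tendsto ht ?_
    filter_upwards [Ioo_mem_nhdsLT h1q] with x hx
    exact key x (ha1'.trans hx.1) (by rw [← h2]; exact_mod_cast hx.2)
  · exact key q h1 h2

lemma lagrange {E : Type*} [AddCommGroup E] [Module ℝ E] (V : Set E) (G : E → ℝ)
    (hG : ConvexOn ℝ V G) (H : E → ℝ)
    (hH : ∀ x y : E, ∀ s t : ℝ, s + t = 1 → H (s • x + t • y) = s * H x + t * H y)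
    (M : ℝ) (hM : ∀ x ∈ V, H x = 0 → M ≤ G x)
    (hp : ∃ x ∈ V, 0 < H x) (hm : ∃ x ∈ V, H x < 0) :
    ∃ ν : ℝ, ∀ x ∈ V, M ≤ G x + ν * H x := by
  have main : ∀ x ∈ V, ∀ y ∈ V, 0 < H x → H y < 0 →
      (M - G y) / (- H y) ≤ (G x - M) / H x := by
    intro x hx y hy hpx hmy
    have hs : 0 < H x - H y := by linarith
    have e1 : (-H y) / (H x - H y) + H x / (H x - H y) = 1 := by field_simp; ring
    have p1 : 0 ≤ (-H y) / (H x - H y) := div_nonneg (by linarith) hs.le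
    have p2 : 0 ≤ H x / (H x - H y) := div_nonneg (by linarith) hs.le
    have h1 := hG.2 hx hy p1 p2 e1
    have h2 := hM _ (hG.1 hx hy p1 p2 e1) (by rw [hH _ _ _ _ e1]; field_simp; ring)
    have h3 := h2.trans h1
    simp only [smul_eq_mul] at h3
    rw [div_mul_eq_mul_div, div_mul_eq_mul_div, ← add_div, le_div_iff₀ hs] at h3
    rw [div_le_div_iff₀ (by linarith) hpx]
    nlinarith
  obtain ⟨x0, hx0, hx0p⟩ := hp
  obtain ⟨y0, hy0, hy0m⟩ := hm
  set S : Set ℝ := {r | ∃ y ∈ V, H y < 0 ∧ r = (M - G y) / (- H y)} with hS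
  have hne : S.Nonempty := ⟨_, y0, hy0, hy0m, rfl⟩
  have hbd : BddAbove S := ⟨(G x0 - M) / H x0, by
    rintro r ⟨y, hy, hym, rfl⟩; exact main x0 hx0 y hy hx0p hym⟩
  refine ⟨- sSup S, fun x hx => ?_⟩
  rcases lt_trichotomy (H x) 0 with h | h | h
  · have := le_csSup hbd ⟨x, hx, h, rfl⟩
    rw [div_le_iff₀ (by linarith)] at this
    linarith
  · rw [h]; linarith [hM x hx h]
  · have : sSup S ≤ (G x - M) / H x := csSup_le hne (by
      rintro r ⟨y, hy, hym, rfl⟩; exact main x hx y hy h hym)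
    rw [le_div_iff₀ h] at this
    linarith

lemma neg_mul_le_iff (c : ℝ) (hc : 0 < c) (x : EReal) (v : ℝ) :
    ((-c : ℝ) : EReal) * x ≤ v ↔ ((-v / c : ℝ) : EReal) ≤ x := by
  induction x with
  | bot => rw [EReal.coe_mul_bot_of_neg (by linarith)]; simp
  | top => rw [EReal.coe_mul_top_of_neg (by linarith)]; simp
  | coe x =>
    norm_cast
    rw [div_le_iff₀ hc]; constructor <;> intro h <;> linarith

lemma le_neg_mul_iff (c : ℝ) (hc : 0 < c) (x : EReal) (v : ℝ) :
    (v : EReal) ≤ ((-c : ℝ) : EReal) * x ↔ x ≤ ((-v / c : ℝ) : EReal) := by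
  induction x with
  | bot => rw [EReal.coe_mul_bot_of_neg (by linarith)]; simp
  | top => rw [EReal.coe_mul_top_of_neg (by linarith)]; simp
  | coe x =>
    norm_cast
    rw [le_div_iff₀ hc]; constructor <;> intro h <;> linarith

lemma sum_coe {n : ℕ} (g : Fin n → ℝ) : ∑ i, ((g i : ℝ) : EReal) = ((∑ i, g i : ℝ) : EReal) := by
  induction (Finset.univ : Finset (Fin n)) using Finset.induction_on with
  | empty => simp
  | insert i s hi ih => rw [Finset.sum_insert hi, Finset.sum_insert hi, ih]; norm_cast

/-- pass from real lower approximations to suprema -/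
lemma sum_sup (n : ℕ) (hn : 0 < n) (l : Fin n → ℝ) (F : ℝ → EReal) (hb : ∀ x, F x ≠ ⊥) (B ν : ℝ)
    (h : ∀ r : ℝ → ℝ, (∀ x, (r x : EReal) < F x) → ν + (n : ℝ)⁻¹ * ∑ i, r (l i) ≤ B) :
    (ν : EReal) + (((n : ℝ)⁻¹ : ℝ) : EReal) * ∑ i, F (l i) ≤ B := by
  have hn' : (0:ℝ) < n := by exact_mod_cast hn
  have h' : ∀ M ε : ℝ, 0 < ε →
      ν + (n : ℝ)⁻¹ * ∑ i, (if F (l i) = ⊤ then M else (F (l i)).toReal - ε) ≤ B := by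
    intro M ε hε
    refine h (fun x => if F x = ⊤ then M else (F x).toReal - ε) fun x => ?_
    by_cases hx : F x = ⊤
    · simp [hx]
    · simp only [hx, if_false]
      conv_rhs => rw [← EReal.coe_toReal hx (hb x)]
      norm_cast; linarith
  have hfin : ∀ i, F (l i) ≠ ⊤ := by
    intro i hi
    set S := ∑ j ∈ Finset.univ.erase i, (if F (l j) = ⊤ then 0 else (F (l j)).toReal - 1) with hS
    have hk : ∀ M : ℝ, 0 ≤ M → ν + (n : ℝ)⁻¹ * (M + S) ≤ B := by
      intro M hM
      refine le_trans ?_ (h' M 1 one_pos)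
      rw [← Finset.add_sum_erase _ _ (Finset.mem_univ i)]
      simp only [hi, if_true]
      gcongr
      rw [hS]
      refine Finset.sum_le_sum fun j _ => ?_
      split_ifs <;> simp [hM]
    have := hk (|(n:ℝ) * (B - ν + 1) - S|) (abs_nonneg _)
    have h2 : (n : ℝ)⁻¹ * ((n:ℝ) * (B - ν + 1)) ≤ (n : ℝ)⁻¹ * (|(n:ℝ) * (B - ν + 1) - S| + S) := by
      gcongr; linarith [le_abs_self ((n:ℝ) * (B - ν + 1) - S)]
    rw [inv_mul_cancel_left₀ hn'.ne'] at h2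
    linarith
  have e : ∀ i, F (l i) = (((F (l i)).toReal : ℝ) : EReal) :=
    fun i => (EReal.coe_toReal (hfin i) (hb _)).symm
  rw [Finset.sum_congr rfl fun i _ => e i, sum_coe]
  norm_cast
  refine le_of_forall_pos_le_add fun ε hε => ?_
  have := h' 0 ε hε
  simp only [hfin, if_false, Finset.sum_sub_distrib, Finset.sum_const, Finset.card_univ,
    Fintype.card_fin, nsmul_eq_mul, mul_sub, inv_mul_cancel_left₀ hn'.ne'] at this
  linarith

lemma feasible {𝒵 : Type*} [MeasurableSpace 𝒵] (n : ℕ) (hn : 0 < n) (z : Fin n → 𝒵)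
    (a : ℝ) (b : EReal) (ha0 : 0 ≤ a) (f : ℝ → ℝ) (L : 𝒵 → ℝ) (hL : Measurable L)
    (φ : ℝ → ℝ) (hφ : Measurable φ) (hfφ : Measurable (fun x => f (φ x)))
    (hab : ∀ x, a < φ x ∧ (φ x : EReal) < b) (hsum : ∑ i, φ (L (z i)) = n) :
    ∃ Q : Measure 𝒵, IsProbabilityMeasure Q ∧
      fDivOn a b f Q (empDist n z) = (((n : ℝ)⁻¹ * ∑ i, f (φ (L (z i))) : ℝ) : EReal) ∧
      ∫ ζ, L ζ ∂Q = (n : ℝ)⁻¹ * ∑ i, L (z i) * φ (L (z i)) := by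
  have hP := emp_prob n hn z
  have hn' : (0:ℝ) < n := by exact_mod_cast hn
  set P := empDist n z with hPdef
  have hpos : ∀ x, 0 ≤ φ x := fun x => ha0.trans (hab x).1.le
  set g : 𝒵 → ℝ≥0∞ := fun ζ => ENNReal.ofReal (φ (L ζ)) with hg
  have hφL : Measurable (fun ζ => φ (L ζ)) := hφ.comp hL
  have hgm : Measurable g := hφL.ennreal_ofReal
  have hint : Integrable (fun ζ => φ (L ζ)) P := emp_integrable n hn z _ hφL.stronglyMeasurable
  have hQ : IsProbabilityMeasure (P.withDensity g) := by
    constructor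
    rw [withDensity_apply _ MeasurableSet.univ, Measure.restrict_univ, hg,
      ← ofReal_integral_eq_lintegral_ofReal hint (Filter.Eventually.of_forall fun _ => hpos _),
      emp_integral n z _ hint.1, hsum, inv_mul_cancel₀ hn'.ne', ENNReal.ofReal_one]
  have hac : P.withDensity g ≪ P := withDensity_absolutelyContinuous _ _
  have hrn : (fun ζ => (((P.withDensity g).rnDeriv P) ζ).toReal) =ᵐ[P] fun ζ => φ (L ζ) := by
    filter_upwards [Measure.rnDeriv_withDensity P hgm] with ζ h
    rw [h, hg]; exact ENNReal.toReal_ofReal (hpos _)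
  have hfint : Integrable (fun ζ => f (φ (L ζ))) P :=
    emp_integrable n hn z _ (hfφ.comp hL).stronglyMeasurable
  have hfrn : (fun ζ => f (((P.withDensity g).rnDeriv P) ζ).toReal) =ᵐ[P]
      fun ζ => f (φ (L ζ)) := by
    filter_upwards [hrn] with ζ h
    rw [h]
  refine ⟨P.withDensity g, hQ, ?_, ?_⟩
  · unfold fDivOn
    rw [if_pos]
    · rw [integral_congr_ae hfrn, emp_integral n z _ hfint.1]
    · refine ⟨hac, ?_, hfint.congr hfrn.symm⟩
      filter_upwards [hrn] with ζ h
      rw [h]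
      exact ⟨(hab _).1.le, (hab _).2.le⟩
  · have h2 : (fun ζ => (((P.withDensity g).rnDeriv P) ζ).toReal • L ζ) =ᵐ[P]
        fun ζ => L ζ * φ (L ζ) := by
      filter_upwards [hrn] with ζ h
      rw [h, smul_eq_mul, mul_comm]
    rw [← integral_rnDeriv_smul hac, integral_congr_ae h2,
      emp_integral n z (fun ζ => L ζ * φ (L ζ)) (hL.mul hφL).stronglyMeasurable.aestronglyMeasurable]

lemma weak {𝒵 : Type*} [MeasurableSpace 𝒵] (n : ℕ) (hn : 0 < n) (z : Fin n → 𝒵)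
    (a : ℝ) (b : EReal) (f : ℝ → ℝ) (L : 𝒵 → ℝ) (hL : Measurable L) (Q : Measure 𝒵)
    [IsProbabilityMeasure Q] (hQ : fDivOn a b f Q (empDist n z) < ⊤) :
    ∃ q : Fin n → ℝ, (∀ i, a ≤ q i ∧ (q i : EReal) ≤ b) ∧ (n : ℝ)⁻¹ * ∑ i, q i = 1 ∧
      fDivOn a b f Q (empDist n z) = (((n : ℝ)⁻¹ * ∑ i, f (q i) : ℝ) : EReal) ∧
      ∫ ζ, L ζ ∂Q = (n : ℝ)⁻¹ * ∑ i, L (z i) * q i := by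
  have hP := emp_prob n hn z
  unfold fDivOn at hQ ⊢
  split_ifs at hQ ⊢ with h
  · obtain ⟨hac, hae, hint⟩ := h
    refine ⟨fun i => (Q.rnDeriv (empDist n z) (z i)).toReal, emp_ae n z _ hae, ?_, ?_, ?_⟩
    · rw [← emp_integral n z (fun ζ => (Q.rnDeriv (empDist n z) ζ).toReal)
        (Q.measurable_rnDeriv _).ennreal_toReal.stronglyMeasurable.aestronglyMeasurable,
        Measure.integral_toReal_rnDeriv hac]
      simp
    · rw [emp_integral n z _ hint.1]
    · rw [← integral_rnDeriv_smul hac, emp_integral n z _ (by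
        simp only [smul_eq_mul]
        exact ((Q.measurable_rnDeriv _).ennreal_toReal.mul
          hL).stronglyMeasurable.aestronglyMeasurable)]
      simp only [smul_eq_mul, mul_comm]
  · exact absurd hQ (lt_irrefl _)

/-- The Gibbs variational formula:
`inf_{Q : D_f(Q‖Pₙ) < ∞} {E_Q[ℒ] + c D_f(Q‖Pₙ)} = −c inf_{ν∈ℝ} {ν + E_{Pₙ}[f*(−ℒ/c − ν)]}`,
where `E_{Pₙ}[g] = (1/n) ∑ᵢ g(zᵢ)`. -/
theorem gibbs_variational_formula
    {𝒵 : Type*} [MeasurableSpace 𝒵] (n : ℕ) (hn : 0 < n) (z : Fin n → 𝒵)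
    (a : ℝ) (b : EReal) (ha0 : 0 ≤ a) (ha1 : (a : EReal) < 1) (hb1 : (1 : EReal) < b)
    (f : ℝ → ℝ) (hf_cvx : ConvexOn ℝ {x : ℝ | a < x ∧ (x : EReal) < b} f) (hf1 : f 1 = 0)
    (hfa : ContinuousWithinAt f (Set.Ioi a) a)
    (hfb : ∀ c : ℝ, b = (c : EReal) → ContinuousWithinAt f (Set.Iio c) c)
    (L : 𝒵 → ℝ) (hL : Measurable L)
    (c : ℝ) (hc : 0 < c) :
    (⨅ Q : {Q : Measure 𝒵 // IsProbabilityMeasure Q ∧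
        fDivOn a b f Q (empDist n z) < ⊤},
      ((∫ ζ, L ζ ∂(Q : Measure 𝒵) : ℝ) : EReal)
        + ((c : ℝ) : EReal) * fDivOn a b f Q (empDist n z))
    = ((-c : ℝ) : EReal) *
        ⨅ ν : ℝ, ((ν : ℝ) : EReal)
          + ((((n : ℝ)⁻¹ : ℝ)) : EReal) *
            ∑ i : Fin n, fStarOn a b f (-(L (z i)) / c - ν) := by
  have hn' : (0:ℝ) < n := by exact_mod_cast hn
  have ha1' : a < 1 := by exact_mod_cast ha1
  apply le_antisymm
  · -- strong duality
    obtain ⟨V0, hV0⟩ : ∃ V : EReal, V = (⨅ Q : {Q : Measure 𝒵 // IsProbabilityMeasure Q ∧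
        fDivOn a b f Q (empDist n z) < ⊤}, ((∫ ζ, L ζ ∂(Q : Measure 𝒵) : ℝ) : EReal)
        + ((c : ℝ) : EReal) * fDivOn a b f Q (empDist n z)) := ⟨_, rfl⟩
    rw [← hV0]
    have hle0 : ∀ φ : ℝ → ℝ, Measurable φ → Measurable (fun x => f (φ x)) →
        (∀ x, a < φ x ∧ (φ x : EReal) < b) → ∑ i, φ (L (z i)) = n →
        V0 ≤ (((n : ℝ)⁻¹ * ∑ i, L (z i) * φ (L (z i)) +
          c * ((n : ℝ)⁻¹ * ∑ i, f (φ (L (z i)))) : ℝ) : EReal) := by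
      intro φ h1 h2 h3 h4
      obtain ⟨Q, q1, q2, q3⟩ := feasible n hn z a b ha0 f L hL φ h1 h2 h3 h4
      rw [hV0]
      refine (iInf_le _ ⟨Q, q1, by rw [q2]; exact EReal.coe_lt_top _⟩).trans ?_
      simp only [q2, q3]
      norm_cast
    have hle : ∀ φ : ℝ → ℝ, (∀ x, a < φ x ∧ (φ x : EReal) < b) → ∑ i, φ (L (z i)) = n →
        V0 ≤ (((n : ℝ)⁻¹ * ∑ i, L (z i) * φ (L (z i)) +
          c * ((n : ℝ)⁻¹ * ∑ i, f (φ (L (z i)))) : ℝ) : EReal) := by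
      intro φ h3 h4
      set S : Set ℝ := Set.range (fun i => L (z i)) with hS
      have hSf : S.Finite := Set.finite_range _
      set ψ : ℝ → ℝ := fun x => if x ∈ S then φ x else 1 with hψ
      have hψL : ∀ i, ψ (L (z i)) = φ (L (z i)) := fun i => if_pos ⟨i, rfl⟩
      have m1 : Measurable ψ := by
        refine (measurable_const (a := (1:ℝ))).measurable_of_countable_ne
          (hSf.countable.mono fun x hx => ?_)
        by_contra hxS
        exact hx (by simp [hψ, hxS])
      have m2 : Measurable (fun x => f (ψ x)) := by
        refine (measurable_const (a := f 1)).measurable_of_countable_ne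
          (hSf.countable.mono fun x hx => ?_)
        by_contra hxS
        exact hx (by simp [hψ, hxS])
      have := hle0 ψ m1 m2 (fun x => by
        simp only [hψ]
        split_ifs
        · exact h3 x
        · exact ⟨ha1', by exact_mod_cast hb1⟩) (by simpa only [hψL] using h4)
      simpa only [hψL] using this
    clear hV0
    induction V0 with
    | bot => exact bot_le
    | top =>
      have := hle (fun _ => 1) (fun _ => ⟨ha1', by exact_mod_cast hb1⟩) (by simp)
      exact absurd this (not_le.2 (EReal.coe_lt_top _))
    | coe v =>
      rw [le_neg_mul_iff c hc]
      let V : Set (ℝ → ℝ) := {φ | ∀ x, a < φ x ∧ (φ x : EReal) < b}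
      let G : (ℝ → ℝ) → ℝ := fun φ => ∑ i, (L (z i) / c * φ (L (z i)) + f (φ (L (z i))))
      let H : (ℝ → ℝ) → ℝ := fun φ => ∑ i, (φ (L (z i)) - 1)
      have hVc : Convex ℝ V := fun φ hφ ψ hψ s t hs ht hst x =>
        hf_cvx.1 (hφ x) (hψ x) hs ht hst
      have hG : ConvexOn ℝ V G := by
        refine ⟨hVc, fun φ hφ ψ hψ s t hs ht hst => ?_⟩
        simp only [G, smul_eq_mul, Finset.mul_sum, ← Finset.sum_add_distrib]
        refine Finset.sum_le_sum fun i _ => ?_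
        have := hf_cvx.2 (hφ (L (z i))) (hψ (L (z i))) hs ht hst
        simp only [Pi.add_apply, Pi.smul_apply, smul_eq_mul] at this ⊢
        linarith
      have hH : ∀ x y : ℝ → ℝ, ∀ s t : ℝ, s + t = 1 → H (s • x + t • y) = s * H x + t * H y := by
        intro x y s t hst
        simp only [H, Finset.mul_sum, ← Finset.sum_add_distrib]
        refine Finset.sum_congr rfl fun i _ => ?_
        simp only [Pi.add_apply, Pi.smul_apply, smul_eq_mul]
        linear_combination hst
      have hconst : ∀ t : ℝ, H (fun _ => t) = n * (t - 1) := by intro t; simp [H]; ring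
      obtain ⟨b', hb'1, hb'b⟩ := EReal.lt_iff_exists_real_btwn.1 hb1
      have hb'1' : 1 < b' := by exact_mod_cast hb'1
      obtain ⟨ν, hν⟩ := lagrange V G hG H hH (n * (v / c)) (by
          intro φ hφ h0
          have h0' : ∑ i, φ (L (z i)) = n := by
            simp only [H, Finset.sum_sub_distrib] at h0
            simp at h0; linarith
          have := hle φ hφ h0'
          have h2 : v ≤ (n : ℝ)⁻¹ * ∑ i, L (z i) * φ (L (z i)) +
            c * ((n : ℝ)⁻¹ * ∑ i, f (φ (L (z i)))) := by exact_mod_cast this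
          have h3 : G φ = (∑ i, L (z i) * φ (L (z i))) / c + ∑ i, f (φ (L (z i))) := by
            simp only [G, Finset.sum_add_distrib, Finset.sum_div]
            congr 1
            exact Finset.sum_congr rfl fun i _ => by ring
          rw [h3, ← sub_nonneg]
          have h4 : (∑ i, L (z i) * φ (L (z i))) / c + ∑ i, f (φ (L (z i))) - n * (v / c)
              = n / c * ((n : ℝ)⁻¹ * ∑ i, L (z i) * φ (L (z i)) +
            c * ((n : ℝ)⁻¹ * ∑ i, f (φ (L (z i)))) - v) := by field_simp
          rw [h4]
          exact mul_nonneg (by positivity) (by linarith))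
        ⟨fun _ => b', fun _ => ⟨ha1'.trans hb'1', hb'b⟩, by
          rw [hconst]; exact mul_pos hn' (by linarith)⟩
        ⟨fun _ => (a + 1) / 2, fun _ => ⟨by linarith, lt_trans (by
          have : (a + 1) / 2 < 1 := by linarith
          exact_mod_cast this) hb1⟩, by
          rw [hconst]; exact mul_neg_of_pos_of_neg hn' (by linarith)⟩
      refine (iInf_le _ ν).trans ?_
      refine sum_sup n hn (fun i => L (z i)) (fun l => fStarOn a b f (-l / c - ν)) ?_ _ _ ?_
      · intro l hl
        have := fStar_ge a b ha1 hb1 f hfa hfb (-l / c - ν) 1 ha1'.le (by exact_mod_cast hb1.le)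
        simp only [hl] at this
        exact absurd this (not_le.2 (EReal.bot_lt_coe _))
      · intro r hr
        have hex : ∀ l, ∃ x : ℝ, (a < x ∧ (x : EReal) < b) ∧ r l < (-l / c - ν) * x - f x := by
          intro l
          obtain ⟨x, hx⟩ := lt_iSup_iff.1 (hr l)
          exact ⟨x, x.2, by exact_mod_cast hx⟩
        choose φ hφ1 hφ2 using hex
        have h1 := hν φ hφ1
        have h2 : ∑ i, r (L (z i)) ≤ - (G φ + ν * H φ) - n * ν := by
          have h3 : - (G φ + ν * H φ) - n * ν =
              ∑ i, ((-(L (z i)) / c - ν) * φ (L (z i)) - f (φ (L (z i)))) := by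
            have h4 : (n : ℝ) * ν = ∑ i : Fin n, ν := by simp
            rw [h4]
            simp only [G, H, Finset.mul_sum, ← Finset.sum_add_distrib, ← Finset.sum_neg_distrib,
              ← Finset.sum_sub_distrib]
            exact Finset.sum_congr rfl fun i _ => by ring
          rw [h3]
          exact Finset.sum_le_sum fun i _ => (hφ2 _).le
        have h5 : (n : ℝ)⁻¹ * ∑ i, r (L (z i)) ≤ (n : ℝ)⁻¹ * (n * (-v / c - ν)) := by
          gcongr
          have : (n : ℝ) * (-v / c - ν) = - (n * (v / c)) - n * ν := by ring
          linarith
        rw [inv_mul_cancel_left₀ hn'.ne'] at h5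
        linarith
  · -- weak duality
    refine le_iInf fun ⟨Q, hQp, hQ⟩ => ?_
    obtain ⟨q, q1, q2, q3, q4⟩ := weak n hn z a b f L hL Q hQ
    simp only [q3, q4]
    rw [← EReal.coe_mul, ← EReal.coe_add, neg_mul_le_iff c hc]
    refine le_iInf fun ν => ?_
    have h1 : ((∑ i, ((-(L (z i)) / c - ν) * q i - f (q i)) : ℝ) : EReal) ≤
        ∑ i : Fin n, fStarOn a b f (-(L (z i)) / c - ν) := by
      rw [← sum_coe]
      exact Finset.sum_le_sum fun i _ => fStar_ge a b ha1 hb1 f hfa hfb _ _ (q1 i).1 (q1 i).2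
    have h2 : ((ν + (n : ℝ)⁻¹ * ∑ i, ((-(L (z i)) / c - ν) * q i - f (q i)) : ℝ) : EReal) ≤
        (ν : EReal) + (((n : ℝ)⁻¹ : ℝ) : EReal) *
          ∑ i : Fin n, fStarOn a b f (-(L (z i)) / c - ν) := by
      rw [EReal.coe_add, EReal.coe_mul]
      gcongr
    refine le_trans (le_of_eq ?_) h2
    congr 1
    have h3 : ∑ i, ((-(L (z i)) / c - ν) * q i - f (q i)) =
        -(∑ i, L (z i) * q i) / c - ν * ∑ i, q i - ∑ i, f (q i) := by
      rw [← Finset.sum_neg_distrib, Finset.sum_div, Finset.mul_sum, ← Finset.sum_sub_distrib,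
        ← Finset.sum_sub_distrib]
      exact Finset.sum_congr rfl fun i _ => by ring
    rw [h3]
    have h4 : (n:ℝ)⁻¹ * (-(∑ i, L (z i) * q i) / c - ν * ∑ i, q i - ∑ i, f (q i)) =
      (n:ℝ)⁻¹ * (-(∑ i, L (z i) * q i) / c) - ν * ((n:ℝ)⁻¹ * ∑ i, q i)
        - (n:ℝ)⁻¹ * ∑ i, f (q i) := by ring
    rw [h4, q2]
    field_simp
    ring
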